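/- Let k ≥ 2 and m ≥ 1, let Γ = (ℤᵏ ⋊ ℤ/2ℤ) × ℤᵐ (with the nontrivial element of ℤ/2ℤ acting on ℤᵏ by negation), and let φ be an automorphism of Γ such that R(φⁿ) is finite for every positive integer n. Then the Reidemeister zeta function of φ is rational: there exist a real number r > 0 and complex polynomials P and Q with Q nonvanishing on the disk |z| < r, such that for all complex z with |z| < r the series ∑_{n=1}^{∞} R(φⁿ) zⁿ/n converges and exp( ∑_{n=1}^{∞} R(φⁿ) zⁿ/n ) = P(z)/Q(z). -/

import Mathlib

open Matrix


/-- Twisted conjugacy relation. -/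
def twistedConj {G : Type*} [Group G] (φ : G →* G) (g g' : G) : Prop :=
  ∃ h : G, g = h * g' * (φ h)⁻¹

/-- Reidemeister number: number of twisted conjugacy classes (0 if infinite). -/
noncomputable def reidemeisterNumber {G : Type*} [Group G] (φ : G →* G) : ℕ :=
  Nat.card (Quot (twistedConj φ))

/-- ℤⁿ written multiplicatively. -/
abbrev Znm (n : ℕ) := Multiplicative (Fin n → ℤ)

/-- The negation automorphism of ℤⁿ. -/
def negAut (n : ℕ) : MulAut (Znm n) := MulEquiv.inv (Znm n)

/-- The action of ℤ/2ℤ on ℤⁿ where the nontrivial element acts by negation. -/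
def negAct (n : ℕ) : Multiplicative (ZMod 2) →* MulAut (Znm n) :=
  MonoidHom.mk' (fun a => negAut n ^ (a.toAdd).val) (by
    have key : negAut n * negAut n = 1 := by
      ext x
      simp [negAut]
    have h2 : ∀ x : ZMod 2, x = 0 ∨ x = 1 := by decide
    intro a b
    rcases h2 a.toAdd with ha | ha <;> rcases h2 b.toAdd with hb | hb <;>
      simp only [toAdd_mul, ha, hb] <;>
      norm_num [show (ZMod.val (2 : ZMod 2)) = 0 from rfl, show (ZMod.val (1 : ZMod 2)) = 1 from rfl,
        show (ZMod.val (0 : ZMod 2)) = 0 from rfl, show ((0+1 : ZMod 2)).val = 1 from rfl,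
        show ((1+0 : ZMod 2)).val = 1 from rfl, pow_succ, key])

/-- The crystallographic group ℤⁿ ⋊ ℤ/2ℤ. -/
abbrev Gamma (n : ℕ) := SemidirectProduct (Znm n) (Multiplicative (ZMod 2)) (negAct n)

/-- The non-torsion-free crystallographic group `(ℤᵏ ⋊ ℤ/2ℤ) × ℤᵐ` with diagonal
holonomy `ℤ/2ℤ`. -/
abbrev GammaProd (k m : ℕ) := Gamma k × Multiplicative (Fin m → ℤ)

section ZetaPart
open Polynomial

theorem det_aeval_pos {k : ℕ} (A : Matrix (Fin k) (Fin k) ℝ) : ∀ (n : ℕ) (g : ℝ[X]), g.natDegree ≤ n →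
    (∀ x : ℝ, 0 < g.eval x) → 0 ≤ (aeval A g).det := by
  intro n
  induction n using Nat.strong_induction_on with
  | _ n ih =>
  intro g hg hpos
  by_cases hd : g.natDegree = 0
  · rw [natDegree_eq_zero] at hd
    obtain ⟨c, rfl⟩ := hd
    have := hpos 0
    simp only [eval_C] at this
    rw [aeval_C, Algebra.algebraMap_eq_smul_one, Matrix.det_smul]
    simp
    positivity
  · have : ∃ z : ℂ, aeval z g = 0 := IsAlgClosed.exists_aeval_eq_zero ℂ g (by
      intro h; exact hd (natDegree_eq_of_degree_eq_some h))
    obtain ⟨z, hz⟩ := this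
    have him : z.im ≠ 0 := by
      intro h
      have hz' : z = ((z.re : ℝ) : ℂ) := by apply Complex.ext <;> simp [h]
      rw [hz'] at hz
      have h1 : aeval ((z.re : ℝ) : ℂ) g = ((g.eval z.re : ℝ) : ℂ) := by
        have := aeval_algebraMap_apply ℂ z.re g
        simpa using this
      rw [h1] at hz
      have := hpos z.re
      exact this.ne' (by exact_mod_cast hz)
    obtain ⟨q, hq⟩ := quadratic_dvd_of_aeval_eq_zero_im_ne_zero g hz him
    have hquad : ∀ x : ℝ, 0 < (X ^ 2 - C (2 * z.re) * X + C (‖z‖ ^ 2) : ℝ[X]).eval x := by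
      intro x
      simp only [eval_add, eval_sub, eval_pow, eval_X, eval_mul, eval_C]
      rw [← Complex.normSq_eq_norm_sq, Complex.normSq_apply]
      have : 0 < z.im * z.im := mul_self_pos.2 him
      nlinarith [sq_nonneg (x - z.re)]
    have hqpos : ∀ x : ℝ, 0 < q.eval x := by
      intro x
      have h1 := hpos x
      rw [hq, eval_mul] at h1
      exact (pos_iff_pos_of_mul_pos h1).1 (hquad x)
    have hq0 : q ≠ 0 := by
      rintro rfl
      simpa using hqpos 0
    have hm : (X ^ 2 - C (2 * z.re) * X + C (‖z‖ ^ 2) : ℝ[X]).natDegree = 2 := by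
      compute_degree!
    have hm0 : (X ^ 2 - C (2 * z.re) * X + C (‖z‖ ^ 2) : ℝ[X]) ≠ 0 := by
      intro h; rw [h] at hm; simp at hm
    have hdeg : g.natDegree = 2 + q.natDegree := by
      conv_lhs => rw [hq]
      rw [natDegree_mul hm0 hq0, hm]
    have h2 := ih q.natDegree (by omega) q le_rfl hqpos
    rw [hq, map_mul, Matrix.det_mul]
    refine mul_nonneg ?_ h2
    -- the quadratic factor
    have e : ((aeval A (X ^ 2 - C (2 * z.re) * X + C (‖z‖ ^ 2) : ℝ[X])).det : ℂ)
        = ((A.map (algebraMap ℝ ℂ)) - z • 1).det * (starRingEnd ℂ) ((A.map (algebraMap ℝ ℂ)) - z • 1).det := by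
      rw [RingHom.map_det, ← Matrix.det_mul]
      have : ∀ M : Matrix (Fin k) (Fin k) ℝ, ((M.det : ℝ) : ℂ) = (M.map (algebraMap ℝ ℂ)).det := by
        intro M
        exact RingHom.map_det (algebraMap ℝ ℂ) M
      rw [this]
      congr 1
      have hs : (starRingEnd ℂ).mapMatrix ((A.map (algebraMap ℝ ℂ)) - z • 1) = (A.map (algebraMap ℝ ℂ)) - (starRingEnd ℂ z) • 1 := by
        ext i j
        by_cases hij : i = j
        · subst hij; simp
        · simp [hij]
      rw [hs]
      have ha : ∀ M N : Matrix (Fin k) (Fin k) ℝ, (M * N).map (algebraMap ℝ ℂ) = M.map (algebraMap ℝ ℂ) * N.map (algebraMap ℝ ℂ) := fun M N => Matrix.map_mul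
      have hl : (aeval A (X ^ 2 - C (2 * z.re) * X + C (‖z‖ ^ 2) : ℝ[X])) = A * A - (2 * z.re) • A + (‖z‖^2) • 1 := by
        rw [map_add, map_sub, map_mul, map_pow, aeval_X, aeval_C, aeval_C, ← Algebra.smul_def,
          Algebra.algebraMap_eq_smul_one, sq A]
      rw [hl]
      have hl2 : (A * A - (2 * z.re) • A + (‖z‖^2) • 1).map (algebraMap ℝ ℂ) =
         A.map (algebraMap ℝ ℂ) * A.map (algebraMap ℝ ℂ) - (2 * z.re : ℂ) • A.map (algebraMap ℝ ℂ) + ((‖z‖^2 : ℝ) : ℂ) • 1 := by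
        rw [← ha]
        ext i j
        by_cases hij : i = j
        · subst hij; simp
        · simp [hij]
      rw [hl2, sub_mul, mul_sub, mul_sub]
      have h3 : z + (starRingEnd ℂ) z = 2 * z.re := by
        have := Complex.add_conj z; simpa using this
      have h4 : z * (starRingEnd ℂ) z = ((‖z‖^2 : ℝ) : ℂ) := by
        rw [Complex.mul_conj, Complex.normSq_eq_norm_sq]
      rw [← h3, ← h4]
      simp only [smul_mul_assoc, mul_smul_comm, one_mul, mul_one, smul_smul, add_smul]
      rw [mul_comm ((starRingEnd ℂ) z) z]
      abel
    rw [Complex.mul_conj] at e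
    have e2 := Complex.ofReal_injective e
    rw [e2]
    exact Complex.normSq_nonneg _

theorem det_aeval_eq {ι : Type*} [Fintype ι] [DecidableEq ι] (A : Matrix ι ι ℂ) (p : ℂ[X]) :
    (aeval A p).det = (A.charpoly.roots.map (fun x => p.eval x)).prod := by
  have hroots : A.charpoly = (A.charpoly.roots.map (fun a => X - C a)).prod := by
    have := (IsAlgClosed.splits A.charpoly).eq_prod_roots
    rwa [A.charpoly_monic.leadingCoeff, C_1, one_mul] at this
  have hC : ∀ c : ℂ, (aeval A (C c)).det = (A.charpoly.roots.map (fun x => (C c).eval x)).prod := by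
    intro c
    have hcard : A.charpoly.roots.card = Fintype.card ι := by
      rw [← (IsAlgClosed.splits A.charpoly).natDegree_eq_card_roots, Matrix.charpoly_natDegree_eq_dim]
    simp [Algebra.algebraMap_eq_smul_one, hcard]
  have hmul : ∀ p q : ℂ[X], (aeval A p).det = (A.charpoly.roots.map (fun x => p.eval x)).prod →
      (aeval A q).det = (A.charpoly.roots.map (fun x => q.eval x)).prod →
      (aeval A (p*q)).det = (A.charpoly.roots.map (fun x => (p*q).eval x)).prod := by
    intro p q hp hq
    simp only [map_mul, Matrix.det_mul, hp, hq, eval_mul, Multiset.prod_map_mul]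
  have hX : ∀ μ : ℂ, (aeval A (X - C μ)).det = (A.charpoly.roots.map (fun x => (X - C μ).eval x)).prod := by
    intro μ
    have h1 : (aeval A (C μ - X)).det = (A.charpoly.roots.map (fun x => (C μ - X).eval x)).prod := by
      have h2 := Matrix.eval_charpoly A μ
      rw [hroots, eval_multiset_prod, Multiset.map_map] at h2
      simp only [map_sub, aeval_C, aeval_X, eval_sub, eval_C, eval_X]
      simp only [Function.comp_def, eval_sub, eval_C, eval_X] at h2
      rw [h2]; rfl
    have := hmul _ _ (hC (-1)) h1
    have e : C (-1) * (C μ - X) = (X - C μ : ℂ[X]) := by simp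
    rwa [e] at this
  have hp := (IsAlgClosed.splits p).eq_prod_roots
  rw [hp]
  refine hmul _ _ (hC _) ?_
  induction p.roots using Multiset.induction_on with
  | empty => simp
  | cons a s ih =>
    rw [Multiset.map_cons, Multiset.prod_cons]
    exact hmul _ _ (hX a) ih

theorem trace_pow_eq {ι : Type*} [Fintype ι] [DecidableEq ι] (A : Matrix ι ι ℂ) (n : ℕ) :
    (A ^ n).trace = (A.charpoly.roots.map (fun x => x ^ n)).sum := by
  rw [Matrix.trace_eq_sum_roots_charpoly]
  congr 1
  have : (A^n).charpoly = ((A.charpoly.roots.map (fun x => x ^ n)).map (fun a => X - C a)).prod := by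
    apply Polynomial.funext
    intro t
    rw [Matrix.eval_charpoly, eval_multiset_prod, Multiset.map_map, Multiset.map_map]
    have := det_aeval_eq A (C t - X ^ n)
    simp only [map_sub, aeval_C, map_pow, aeval_X, eval_sub, eval_C, eval_pow, eval_X] at this
    simp only [Function.comp_def, eval_sub, eval_C, eval_X]
    rw [← this]; rfl
  rw [this, roots_multiset_prod_X_sub_C]
theorem abs_det_of_factor {k : ℕ} (A : Matrix (Fin k) (Fin k) ℝ) (p h g : ℝ[X]) (σ : ℝ)
    (hp : p = h * g) (hg : ∀ x : ℝ, 0 < g.eval x)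
    (hσ : |(aeval A h).det| = σ * (aeval A h).det) : |(aeval A p).det| = σ * (aeval A p).det := by
  have h1 := det_aeval_pos A _ g le_rfl hg
  rw [hp, map_mul, Matrix.det_mul, abs_mul, hσ, abs_of_nonneg h1, mul_assoc]

theorem exists_sign (u : ℝ) : ∃ s : ℤ, (s = 1 ∨ s = -1) ∧ |u| = s * u := by
  rcases le_total 0 u with h | h
  · exact ⟨1, Or.inl rfl, by simp [abs_of_nonneg h]⟩
  · exact ⟨-1, Or.inr rfl, by simp [abs_of_nonpos h]⟩

theorem abs_det_real {k : ℕ} (A : Matrix (Fin k) (Fin k) ℝ) : ∃ s t : ℤ, (s = 1 ∨ s = -1) ∧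
    (t = 1 ∨ t = -1) ∧ ∀ n : ℕ, 0 < n →
      |(1 - A ^ n).det| = s * t * t ^ n * (1 - A ^ n).det ∧
      |(1 + A ^ n).det| = t ^ n * (1 + A ^ n).det := by
  obtain ⟨s, hs, hs'⟩ := exists_sign (1 - A).det
  obtain ⟨t, ht, ht'⟩ := exists_sign (1 + A).det
  have htt : (t : ℝ) * t = 1 := by rcases ht with rfl | rfl <;> simp
  refine ⟨s, t, hs, ht, fun n hn => ?_⟩
  have e1 : aeval A (1 - X ^ n : ℝ[X]) = 1 - A ^ n := by simp
  have e2 : aeval A (1 + X ^ n : ℝ[X]) = 1 + A ^ n := by simp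
  rcases Nat.even_or_odd n with he | ho
  · have htn : (t : ℝ) ^ n = 1 := by
      rcases ht with rfl | rfl
      · simp
      · simp [he.neg_one_pow]
    obtain ⟨l, hl⟩ := he
    have hl' : n = 2 * l := by omega
    constructor
    · rw [htn, mul_one, ← e1]
      refine abs_det_of_factor A _ ((1 - X) * (1 + X)) (∑ i ∈ Finset.range l, (X ^ 2) ^ i) _ ?_ ?_ ?_
      · have := mul_neg_geom_sum (X ^ 2 : ℝ[X]) l
        rw [← pow_mul, ← hl'] at this
        rw [← this]; ring
      · intro x
        simp only [eval_finsetSum, eval_pow, eval_X]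
        have : 0 < l := by omega
        refine Finset.sum_pos' (fun i _ => by positivity) ⟨0, by simpa using this, by simp⟩
      · simp only [map_mul, map_sub, map_add, map_one, aeval_X, Matrix.det_mul, abs_mul, hs', ht']
        ring
    · rw [htn, ← e2]
      refine abs_det_of_factor A _ 1 (1 + X ^ n) _ (by simp) ?_ (by simp)
      intro x
      have : 0 ≤ x ^ n := Even.pow_nonneg ⟨l, hl⟩ x
      simp
      linarith
  · have htn : (t : ℝ) ^ n = t := by
      rcases ht with rfl | rfl
      · simp
      · simp [ho.neg_one_pow]
    constructor
    · rw [htn, mul_assoc (s : ℝ), htt, mul_one, ← e1]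
      refine abs_det_of_factor A _ (1 - X) (∑ i ∈ Finset.range n, X ^ i) _ ?_ ?_ ?_
      · rw [mul_neg_geom_sum]
      · intro x
        simp only [eval_finsetSum, eval_pow, eval_X]
        exact ho.geom_sum_pos
      · simpa using hs'
    · rw [htn, ← e2]
      refine abs_det_of_factor A _ (1 + X) (∑ i ∈ Finset.range n, (-X) ^ i) _ ?_ ?_ ?_
      · have := mul_neg_geom_sum (-X : ℝ[X]) n
        rw [ho.neg_pow] at this
        simpa using this.symm
      · intro x
        simp only [eval_finsetSum, eval_pow, eval_X, eval_neg]
        exact ho.geom_sum_pos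
      · simpa using ht'

theorem abs_det_int {k : ℕ} (A : Matrix (Fin k) (Fin k) ℤ) : ∃ s t : ℤ, (s = 1 ∨ s = -1) ∧
    (t = 1 ∨ t = -1) ∧ ∀ n : ℕ, 0 < n →
      |(1 - A ^ n).det| = s * t * t ^ n * (1 - A ^ n).det ∧
      |(1 + A ^ n).det| = t ^ n * (1 + A ^ n).det := by
  obtain ⟨s, t, hs, ht, h⟩ := abs_det_real ((Int.castRingHom ℝ).mapMatrix A)
  refine ⟨s, t, hs, ht, fun n hn => ?_⟩
  have e1 : (((1 - A ^ n).det : ℤ) : ℝ) = (1 - ((Int.castRingHom ℝ).mapMatrix A) ^ n).det := by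
    have := RingHom.map_det (Int.castRingHom ℝ) (1 - A ^ n)
    rw [map_sub, map_pow, map_one] at this
    exact this
  have e2 : (((1 + A ^ n).det : ℤ) : ℝ) = (1 + ((Int.castRingHom ℝ).mapMatrix A) ^ n).det := by
    have := RingHom.map_det (Int.castRingHom ℝ) (1 + A ^ n)
    rw [map_add, map_pow, map_one] at this
    exact this
  have := h n hn
  rw [← e1, ← e2] at this
  exact_mod_cast this

/-- The exponential sequences `n ↦ μ ^ (n+1)`. -/
def expSeq (μ : ℂ) : ℕ → ℂ := fun n => μ ^ (n + 1)

/-- Integer combinations of exponential sequences. -/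
noncomputable def expRing : Subring (ℕ → ℂ) := Subring.closure (Set.range expSeq)

theorem expSeq_mem (μ : ℂ) : expSeq μ ∈ expRing := Subring.subset_closure ⟨μ, rfl⟩

theorem expRing_rational (f : ℕ → ℂ) (hf : f ∈ expRing) :
    ∃ (r : ℝ) (P Q : Polynomial ℂ), 0 < r ∧
      (∀ z : ℂ, ‖z‖ < r → P.eval z ≠ 0) ∧ (∀ z : ℂ, ‖z‖ < r → Q.eval z ≠ 0) ∧
      ∀ z : ℂ, ‖z‖ < r → ∃ s : ℂ, HasSum (fun j : ℕ => f j * z ^ (j + 1) / (j + 1)) s ∧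
          Complex.exp s = P.eval z / Q.eval z := by
  have hcl : (Submonoid.closure (Set.range expSeq) : Set (ℕ → ℂ)) ⊆ Set.range expSeq := by
    intro x hx
    induction hx using Submonoid.closure_induction with
    | mem x hx => exact hx
    | one => exact ⟨1, by ext; simp [expSeq]⟩
    | mul x y _ _ hx hy =>
      obtain ⟨a, rfl⟩ := hx
      obtain ⟨b, rfl⟩ := hy
      exact ⟨a * b, by ext; simp [expSeq, mul_pow]⟩
  have hf' := AddSubgroup.closure_mono hcl (Subring.mem_closure_iff.1 hf)
  clear hf
  induction hf' using AddSubgroup.closure_induction with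
  | mem x hx =>
    obtain ⟨μ, rfl⟩ := hx
    have key : ∀ z : ℂ, ‖z‖ < 1 / (‖μ‖ + 1) → ‖μ * z‖ < 1 := by
      intro z hz
      rw [lt_div_iff₀ (by positivity)] at hz
      rw [norm_mul]
      nlinarith [norm_nonneg z, norm_nonneg μ]
    have key2 : ∀ z : ℂ, ‖z‖ < 1 / (‖μ‖ + 1) → 1 - μ * z ≠ 0 := by
      intro z hz h
      have := key z hz
      rw [← sub_eq_zero.1 h] at this
      simp at this
    refine ⟨1 / (‖μ‖ + 1), 1, 1 - C μ * X, by positivity, by simp, ?_, ?_⟩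
    · intro z hz
      simpa using key2 z hz
    · intro z hz
      refine ⟨-Complex.log (1 - μ * z), ?_, ?_⟩
      · have := Complex.hasSum_taylorSeries_neg_log' (key z hz)
        simpa [expSeq, mul_pow] using this
      · rw [Complex.exp_neg, Complex.exp_log (key2 z hz)]
        simp
  | zero =>
    refine ⟨1, 1, 1, one_pos, by simp, by simp, fun z _ => ⟨0, ?_, by simp⟩⟩
    simp
  | add x y _ _ hx hy =>
    obtain ⟨r, P, Q, hr, hP, hQ, h⟩ := hx
    obtain ⟨r', P', Q', hr', hP', hQ', h'⟩ := hy
    refine ⟨min r r', P * P', Q * Q', lt_min hr hr', ?_, ?_, ?_⟩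
    · intro z hz
      rw [eval_mul]
      exact mul_ne_zero (hP z (lt_of_lt_of_le hz (min_le_left _ _))) (hP' z (lt_of_lt_of_le hz (min_le_right _ _)))
    · intro z hz
      rw [eval_mul]
      exact mul_ne_zero (hQ z (lt_of_lt_of_le hz (min_le_left _ _))) (hQ' z (lt_of_lt_of_le hz (min_le_right _ _)))
    · intro z hz
      obtain ⟨s, hs, e⟩ := h z (lt_of_lt_of_le hz (min_le_left _ _))
      obtain ⟨s', hs', e'⟩ := h' z (lt_of_lt_of_le hz (min_le_right _ _))
      refine ⟨s + s', ?_, ?_⟩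
      · convert hs.add hs' using 2
        simp only [Pi.add_apply]
        ring
      · rw [Complex.exp_add, e, e', eval_mul, eval_mul, div_mul_div_comm]
  | neg x _ hx =>
    obtain ⟨r, P, Q, hr, hP, hQ, h⟩ := hx
    refine ⟨r, Q, P, hr, hQ, hP, fun z hz => ?_⟩
    obtain ⟨s, hs, e⟩ := h z hz
    refine ⟨-s, ?_, ?_⟩
    · have e : (fun j : ℕ => (-x) j * z ^ (j + 1) / ((j : ℂ) + 1)) =
          fun j : ℕ => -(x j * z ^ (j + 1) / ((j : ℂ) + 1)) := by
        funext j
        rw [Pi.neg_apply]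
        ring
      rw [e]
      exact hs.neg
    · rw [Complex.exp_neg, e, inv_div]

theorem half_prod_mem (L : Multiset ℂ) :
    (fun n : ℕ => ((L.map (fun x => 1 + x ^ (n + 1))).prod + (L.map (fun x => 1 - x ^ (n + 1))).prod) / 2) ∈ expRing ∧
    (fun n : ℕ => ((L.map (fun x => 1 + x ^ (n + 1))).prod - (L.map (fun x => 1 - x ^ (n + 1))).prod) / 2) ∈ expRing := by
  induction L using Multiset.induction_on with
  | empty =>
    constructor
    · convert expRing.one_mem using 1
      ext n; simp
    · convert expRing.zero_mem using 1
      ext n; simp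
  | cons a L ih =>
    obtain ⟨h1, h2⟩ := ih
    constructor
    · convert expRing.add_mem h1 (expRing.mul_mem (expSeq_mem a) h2) using 1
      ext n
      simp [expSeq]; ring
    · convert expRing.add_mem h2 (expRing.mul_mem (expSeq_mem a) h1) using 1
      ext n
      simp [expSeq]; ring

theorem det_cast_eq {k : ℕ} (A : Matrix (Fin k) (Fin k) ℤ) (n : ℕ) :
    (((1 - A ^ n).det : ℤ) : ℂ) = (((Int.castRingHom ℂ).mapMatrix A).charpoly.roots.map (fun x => 1 - x ^ n)).prod ∧
    (((1 + A ^ n).det : ℤ) : ℂ) = (((Int.castRingHom ℂ).mapMatrix A).charpoly.roots.map (fun x => 1 + x ^ n)).prod := by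
  constructor
  · have := RingHom.map_det (Int.castRingHom ℂ) (1 - A ^ n)
    rw [map_sub, map_pow, map_one] at this
    refine this.trans ?_
    have := det_aeval_eq ((Int.castRingHom ℂ).mapMatrix A) (1 - X ^ n)
    simpa only [map_sub, map_pow, map_one, aeval_X, eval_sub, eval_pow, eval_X, eval_one] using this
  · have := RingHom.map_det (Int.castRingHom ℂ) (1 + A ^ n)
    rw [map_add, map_pow, map_one] at this
    refine this.trans ?_
    have := det_aeval_eq ((Int.castRingHom ℂ).mapMatrix A) (1 + X ^ n)
    simpa only [map_add, map_pow, map_one, aeval_X, eval_add, eval_pow, eval_X, eval_one] using this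

theorem half_det_mem {k : ℕ} (A : Matrix (Fin k) (Fin k) ℤ) :
    (fun n : ℕ => (((|(1 - A ^ (n + 1)).det| + |(1 + A ^ (n + 1)).det| : ℤ) : ℂ) / 2)) ∈ expRing := by
  obtain ⟨s, t, hs, ht, h⟩ := abs_det_int A
  obtain ⟨h1, h2⟩ := half_prod_mem ((Int.castRingHom ℂ).mapMatrix A).charpoly.roots
  have hst : s * t = 1 ∨ s * t = -1 := by
    rcases hs with rfl | rfl <;> rcases ht with rfl | rfl <;> simp
  rcases hst with hst | hst
  · convert expRing.mul_mem (expSeq_mem t) h1 using 1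
    ext n
    obtain ⟨e1, e2⟩ := h (n + 1) n.succ_pos
    obtain ⟨d1, d2⟩ := det_cast_eq A (n + 1)
    rw [e1, e2, hst]
    simp only [Int.cast_add, Int.cast_mul, Int.cast_pow, Int.cast_one]
    rw [d1, d2]
    simp only [Pi.mul_apply, expSeq]
    ring
  · convert expRing.mul_mem (expSeq_mem t) h2 using 1
    ext n
    obtain ⟨e1, e2⟩ := h (n + 1) n.succ_pos
    obtain ⟨d1, d2⟩ := det_cast_eq A (n + 1)
    rw [e1, e2, hst]
    simp only [Int.cast_add, Int.cast_mul, Int.cast_pow, Int.cast_one, Int.cast_neg]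
    rw [d1, d2]
    simp only [Pi.mul_apply, expSeq]
    ring

theorem abs_det_mem {k : ℕ} (A : Matrix (Fin k) (Fin k) ℤ) :
    (fun n : ℕ => ((|(1 - A ^ (n + 1)).det| : ℤ) : ℂ)) ∈ expRing := by
  obtain ⟨s, t, hs, ht, h⟩ := abs_det_int A
  obtain ⟨h1, h2⟩ := half_prod_mem ((Int.castRingHom ℂ).mapMatrix A).charpoly.roots
  have hst : ((s * t : ℤ) : ℕ → ℂ) ∈ expRing := intCast_mem _ _
  convert expRing.mul_mem hst (expRing.mul_mem (expSeq_mem t) (expRing.sub_mem h1 h2)) using 1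
  ext n
  obtain ⟨e1, e2⟩ := h (n + 1) n.succ_pos
  obtain ⟨d1, d2⟩ := det_cast_eq A (n + 1)
  rw [e1]
  simp only [Int.cast_mul, Int.cast_pow]
  rw [d1]
  simp only [Pi.mul_apply, expSeq, Pi.sub_apply, Pi.intCast_apply]
  ring

theorem fixed_mem {V : Type*} [Fintype V] [DecidableEq V] (f : V → V) :
    (fun n : ℕ => ((Nat.card {v : V // f^[n + 1] v = v} : ℕ) : ℂ)) ∈ expRing := by
  have h : ∀ L : Multiset ℂ, (fun n : ℕ => (L.map (fun x => x ^ (n + 1))).sum) ∈ expRing := by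
    intro L
    induction L using Multiset.induction_on with
    | empty =>
      convert expRing.zero_mem using 1
      ext n; simp
    | cons a L ih =>
      convert expRing.add_mem (expSeq_mem a) ih using 1
      ext n; simp [expSeq]
  set M : Matrix V V ℂ := Matrix.of fun i j => if i = f j then (1 : ℂ) else 0
  convert h M.charpoly.roots using 1
  ext n
  rw [← trace_pow_eq]
  have hp : ∀ n : ℕ, M ^ n = Matrix.of fun i j => if i = f^[n] j then (1 : ℂ) else 0 := by
    intro n
    induction n with
    | zero => ext i j; simp only [pow_zero, Matrix.one_apply, Matrix.of_apply, Function.iterate_zero, id]; congr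
    | succ n ih =>
      rw [pow_succ, ih]
      ext i j
      simp only [M, Matrix.mul_apply, Matrix.of_apply, Function.iterate_succ, Function.comp]
      rw [Finset.sum_eq_single (f j)]
      · rw [if_pos rfl, mul_one]; congr
      · intro b _ hb; simp [hb]
      · simp
  rw [hp, Matrix.trace]
  simp only [Matrix.diag, Matrix.of_apply]
  rw [Finset.sum_boole, Nat.card_eq_fintype_card, Fintype.card_subtype]
  congr 2
  ext x
  simp only [Finset.mem_filter, Finset.mem_univ, true_and]
  exact eq_comm
end ZetaPart

theorem invol_card {X : Type*} (σ : X → X) (hσ : ∀ x, σ (σ x) = x)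
    (r : X → X → Prop) (hr : ∀ x y, r x y ↔ (x = y ∨ x = σ y)) (hf : Finite (Quot r)) :
    Finite X ∧ Nat.card X + Nat.card {x // σ x = x} = 2 * Nat.card (Quot r) := by
  classical
  have hmk : ∀ x y, Quot.mk r x = Quot.mk r y ↔ (x = y ∨ x = σ y) := by
    intro x y
    have he : Equivalence r := by
      refine ⟨fun x => (hr x x).2 (Or.inl rfl), ?_, ?_⟩
      · intro x y h
        rw [hr] at h ⊢
        rcases h with h | h
        · exact Or.inl h.symm
        · right; rw [h, hσ]
      · intro x y z h h'
        rw [hr] at h h' ⊢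
        rcases h with rfl | rfl <;> rcases h' with rfl | rfl <;> simp [hσ]
    rw [← hr]
    exact ⟨fun h => he.eqvGen_iff.1 (Quot.eqvGen_exact h), fun h => Quot.sound h⟩
  have hX : Finite X := by
    refine Finite.of_surjective (fun p : Quot r × Bool => if p.2 then p.1.out else σ p.1.out) ?_
    intro x
    have h := (hmk _ _).1 (Quot.out_eq (Quot.mk r x))
    rcases h with h | h
    · exact ⟨(Quot.mk r x, true), by simpa using h⟩
    · exact ⟨(Quot.mk r x, false), by simp [h, hσ]⟩
  refine ⟨hX, ?_⟩
  have := Fintype.ofFinite X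
  have := Fintype.ofFinite (Quot r)
  rw [Nat.card_eq_fintype_card, Nat.card_eq_fintype_card, Nat.card_eq_fintype_card,
    Fintype.card_subtype, ← Finset.card_univ (α := X),
    Finset.card_eq_sum_card_fiberwise (f := Quot.mk r) (t := Finset.univ) (by simp [Set.MapsTo]),
    Finset.card_eq_sum_card_fiberwise (f := Quot.mk r) (s := Finset.univ.filter fun x => σ x = x)
      (t := Finset.univ) (by simp [Set.MapsTo]), ← Finset.sum_add_distrib]
  rw [Finset.sum_congr rfl (g := fun _ => 2)]
  · simp [mul_comm]
  · intro q _
    induction q using Quot.ind with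
    | mk x =>
    by_cases hx : σ x = x
    · have h1 : (Finset.univ.filter fun a => Quot.mk r a = Quot.mk r x) = {x} := by
        ext a; simp [hmk, hx]
      have h2 : ((Finset.univ.filter fun x => σ x = x).filter fun a => Quot.mk r a = Quot.mk r x) = {x} := by
        ext a; simp only [Finset.mem_filter, Finset.mem_univ, true_and, Finset.mem_singleton, hmk, hx, or_self]
        constructor
        · exact fun h => h.2
        · rintro rfl; exact ⟨hx, rfl⟩
      rw [h1, h2]; simp
    · have h1 : (Finset.univ.filter fun a => Quot.mk r a = Quot.mk r x) = {x, σ x} := by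
        ext a; simp [hmk]
      have h2 : ((Finset.univ.filter fun x => σ x = x).filter fun a => Quot.mk r a = Quot.mk r x) = ∅ := by
        ext a; simp only [Finset.mem_filter, Finset.mem_univ, true_and, hmk, Finset.notMem_empty, iff_false]
        rintro ⟨h, rfl | rfl⟩
        · exact hx h
        · rw [hσ] at h; exact hx h.symm
      rw [h1, h2, Finset.card_pair (Ne.symm hx)]; simp

/-- Cokernel of an integer matrix. -/
abbrev Coker {k : ℕ} (M : Matrix (Fin k) (Fin k) ℤ) := (Fin k → ℤ) ⧸ LinearMap.range M.mulVecLin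

theorem coker_eq {k : ℕ} (M : Matrix (Fin k) (Fin k) ℤ) (x y : Fin k → ℤ) :
    (Submodule.Quotient.mk x : Coker M) = Submodule.Quotient.mk y ↔ ∃ w, M.mulVec w = x - y := by
  rw [Submodule.Quotient.eq]; rfl

theorem coker_det {k : ℕ} (M : Matrix (Fin k) (Fin k) ℤ) (hf : Finite (Coker M)) : M.det ≠ 0 := by
  have hn : Nat.card (Coker M) ≠ 0 := Nat.card_pos.ne'
  have h : ∀ i : Fin k, ∃ w, M.mulVec w = Nat.card (Coker M) • (Pi.single i 1 : Fin k → ℤ) := by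
    intro i
    have h1 : Nat.card (Coker M) • (Submodule.Quotient.mk (Pi.single i 1) : Coker M) = 0 := card_nsmul_eq_zero'
    rw [← Submodule.Quotient.mk_smul, Submodule.Quotient.mk_eq_zero] at h1
    exact h1
  choose w hw using h
  have h2 : M * (Matrix.of w).transpose = ((Nat.card (Coker M) : ℤ)) • (1 : Matrix (Fin k) (Fin k) ℤ) := by
    ext a b
    have := congrFun (hw b) a
    simp only [Matrix.mulVec, dotProduct] at this
    simp only [Matrix.mul_apply, Matrix.transpose_apply, Matrix.of_apply, this]
    simp [Matrix.one_apply, Pi.single_apply]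
  have h3 := congrArg Matrix.det h2
  rw [Matrix.det_mul, Matrix.det_smul, Matrix.det_one, mul_one] at h3
  intro h0
  rw [h0, zero_mul] at h3
  exact (pow_ne_zero _ (Int.natCast_ne_zero.2 hn)) h3.symm

theorem mulVec_inj {k : ℕ} (M : Matrix (Fin k) (Fin k) ℤ) (hM : M.det ≠ 0) :
    Function.Injective M.mulVec :=
  Matrix.mulVec_injective_of_det_ne_zero hM

theorem coker_card {k : ℕ} (M : Matrix (Fin k) (Fin k) ℤ) (hM : M.det ≠ 0) :
    Nat.card (Coker M) = M.det.natAbs := by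
  have hinj : Function.Injective M.mulVecLin := mulVec_inj M hM
  have h := Submodule.natAbs_det_equiv (LinearMap.range M.mulVecLin) (LinearEquiv.ofInjective _ hinj)
  rw [← h]
  have e : (LinearMap.range M.mulVecLin).subtype ∘ₗ AddMonoidHom.toIntLinearMap
      ((LinearEquiv.ofInjective _ hinj : (Fin k → ℤ) ≃ₗ[ℤ] _) : (Fin k → ℤ) →+ LinearMap.range M.mulVecLin) = Matrix.toLin' M := by
    ext; rfl
  rw [e, LinearMap.det_toLin']

/-- Reduction mod two. -/
def red {k : ℕ} (x : Fin k → ℤ) : Fin k → ZMod 2 := fun i => (x i : ZMod 2)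

theorem red_surj {k : ℕ} (v : Fin k → ZMod 2) : ∃ x : Fin k → ℤ, red x = v := by
  refine ⟨fun i => ((v i).val : ℤ), ?_⟩
  ext i
  simp [red]

theorem red_eq {k : ℕ} (x y : Fin k → ℤ) : red x = red y ↔ ∃ w : Fin k → ℤ, x - y = w + w := by
  constructor
  · intro h
    have : ∀ i, ∃ w : ℤ, x i - y i = w + w := by
      intro i
      have h1 := congrFun h i
      simp only [red] at h1
      rw [← sub_eq_zero, ← Int.cast_sub, ZMod.intCast_zmod_eq_zero_iff_dvd] at h1
      obtain ⟨w, hw⟩ := h1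
      exact ⟨w, by push_cast at hw; omega⟩
    choose w hw using this
    exact ⟨w, funext hw⟩
  · rintro ⟨w, hw⟩
    ext i
    have h1 := congrFun hw i
    simp only [Pi.sub_apply, Pi.add_apply] at h1
    simp only [red]
    rw [← sub_eq_zero, ← Int.cast_sub, ZMod.intCast_zmod_eq_zero_iff_dvd]
    exact ⟨w i, by push_cast; omega⟩

theorem red_mulVec {k : ℕ} (M : Matrix (Fin k) (Fin k) ℤ) (x : Fin k → ℤ) :
    red (M.mulVec x) = ((Int.castRingHom (ZMod 2)).mapMatrix M).mulVec (red x) := by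
  ext i
  simp [red, Matrix.mulVec, dotProduct]

theorem fix_card {k : ℕ} (M : Matrix (Fin k) (Fin k) ℤ) (hM : M.det ≠ 0) (d : Fin k → ℤ) :
    Nat.card {x : Coker M // Submodule.Quotient.mk d - x = x} =
      Nat.card {v : Fin k → ZMod 2 // ((Int.castRingHom (ZMod 2)).mapMatrix M).mulVec v = red d} := by
  symm
  have h : ∀ v : {v : Fin k → ZMod 2 // ((Int.castRingHom (ZMod 2)).mapMatrix M).mulVec v = red d},
      ∃ u a : Fin k → ℤ, red u = v.1 ∧ M.mulVec u + d = a + a := by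
    rintro ⟨v, hv⟩
    obtain ⟨u, hu⟩ := red_surj v
    rw [← hu, ← red_mulVec, red_eq] at hv
    obtain ⟨w, hw⟩ := hv
    exact ⟨u, w + d, hu, by rw [← sub_add_cancel (M.mulVec u) d, hw]; abel⟩
  choose u a hu ha using h
  refine Nat.card_eq_of_bijective (fun v => ⟨Submodule.Quotient.mk (a v), ?_⟩) ⟨?_, ?_⟩
  · rw [← Submodule.Quotient.mk_sub, coker_eq]
    refine ⟨-u v, ?_⟩
    rw [Matrix.mulVec_neg, sub_sub, ← ha]; abel
  · intro v v' h
    simp only [Subtype.mk.injEq, coker_eq] at h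
    obtain ⟨w, hw⟩ := h
    apply Subtype.ext
    rw [← hu v, ← hu v', red_eq]
    refine ⟨w, mulVec_inj M hM ?_⟩
    rw [Matrix.mulVec_sub, Matrix.mulVec_add, hw]
    have h1 := eq_sub_of_add_eq (ha v)
    have h2 := eq_sub_of_add_eq (ha v')
    rw [h1, h2]; abel
  · rintro ⟨x, hx⟩
    obtain ⟨b, rfl⟩ := Submodule.Quotient.mk_surjective _ x
    rw [← Submodule.Quotient.mk_sub, coker_eq] at hx
    obtain ⟨w, hw⟩ := hx
    have hv : ((Int.castRingHom (ZMod 2)).mapMatrix M).mulVec (red w) = red d := by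
      rw [← red_mulVec, red_eq]
      exact ⟨-b, by rw [hw]; abel⟩
    refine ⟨⟨red w, hv⟩, ?_⟩
    apply Subtype.ext
    simp only
    rw [coker_eq]
    have h1 := hu ⟨red w, hv⟩
    simp only at h1
    rw [red_eq] at h1
    obtain ⟨t, ht⟩ := h1
    have h2 := ha ⟨red w, hv⟩
    -- u = w + 2t; 2a = M u + d = d - 2b + ... 
    refine ⟨t + w, ?_⟩
    have h3 := congrArg M.mulVec ht
    rw [Matrix.mulVec_sub, Matrix.mulVec_add] at h3
    have h4 := eq_sub_of_add_eq h2
    rw [h4, hw] at h3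
    rw [Matrix.mulVec_add, hw]
    ext i
    have h5 := congrFun h3 i
    simp only [Pi.sub_apply, Pi.add_apply] at h5 ⊢
    omega

section GroupPart
variable {k m : ℕ}

/-- Elements of the translation subgroup. -/
def E0 (a : Fin k → ℤ) (b : Fin m → ℤ) : GammaProd k m :=
  (⟨Multiplicative.ofAdd a, Multiplicative.ofAdd 0⟩, Multiplicative.ofAdd b)

/-- Elements outside of the translation subgroup. -/
def E1 (a : Fin k → ℤ) (b : Fin m → ℤ) : GammaProd k m :=
  (⟨Multiplicative.ofAdd a, Multiplicative.ofAdd 1⟩, Multiplicative.ofAdd b)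

theorem negAct_zero : negAct k (Multiplicative.ofAdd 0) = 1 := map_one (negAct k)

theorem negAct_one (x : Znm k) : negAct k (Multiplicative.ofAdd 1) x = x⁻¹ := by
  have : negAct k (Multiplicative.ofAdd 1) = negAut k ^ (1 : ZMod 2).val := rfl
  rw [this, show (1 : ZMod 2).val = 1 from rfl, pow_one]
  rfl

theorem E_cases (g : GammaProd k m) : (∃ a b, g = E0 a b) ∨ (∃ a b, g = E1 a b) := by
  obtain ⟨⟨a, e⟩, b⟩ := g
  have h2 : ∀ x : ZMod 2, x = 0 ∨ x = 1 := by decide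
  rcases h2 (Multiplicative.toAdd e) with h | h
  · exact Or.inl ⟨Multiplicative.toAdd a, Multiplicative.toAdd b, by
      rw [E0, ← h]; rfl⟩
  · exact Or.inr ⟨Multiplicative.toAdd a, Multiplicative.toAdd b, by
      rw [E1, ← h]; rfl⟩

theorem E0_inj {a a' : Fin k → ℤ} {b b' : Fin m → ℤ} : E0 a b = E0 a' b' ↔ a = a' ∧ b = b' := by
  simp [E0, Prod.ext_iff, SemidirectProduct.ext_iff]

theorem E1_inj {a a' : Fin k → ℤ} {b b' : Fin m → ℤ} : E1 a b = E1 a' b' ↔ a = a' ∧ b = b' := by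
  simp [E1, Prod.ext_iff, SemidirectProduct.ext_iff]

theorem E0_ne_E1 (a a' : Fin k → ℤ) (b b' : Fin m → ℤ) : E0 a b ≠ E1 a' b' := by
  intro h
  have h1 : (Multiplicative.ofAdd (0 : ZMod 2)) = Multiplicative.ofAdd 1 :=
    congrArg (fun g : GammaProd k m => g.1.right) h
  exact absurd (Multiplicative.ofAdd.injective h1) (by decide)

theorem E00 (a a' : Fin k → ℤ) (b b' : Fin m → ℤ) : E0 a b * E0 a' b' = E0 (a + a') (b + b') := by
  refine Prod.ext (SemidirectProduct.ext ?_ rfl) rfl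
  simp [E0, negAct_zero, ofAdd_add]

theorem E01 (a a' : Fin k → ℤ) (b b' : Fin m → ℤ) : E0 a b * E1 a' b' = E1 (a + a') (b + b') := by
  refine Prod.ext (SemidirectProduct.ext ?_ rfl) rfl
  simp [E0, E1, negAct_zero, ofAdd_add]

theorem E10 (a a' : Fin k → ℤ) (b b' : Fin m → ℤ) : E1 a b * E0 a' b' = E1 (a - a') (b + b') := by
  refine Prod.ext (SemidirectProduct.ext ?_ rfl) rfl
  simp [E0, E1, negAct_one, ofAdd_sub, div_eq_mul_inv]

theorem E11 (a a' : Fin k → ℤ) (b b' : Fin m → ℤ) : E1 a b * E1 a' b' = E0 (a - a') (b + b') := by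
  refine Prod.ext (SemidirectProduct.ext ?_ (show Multiplicative.ofAdd ((1 : ZMod 2) + 1) = Multiplicative.ofAdd 0 from congrArg _ (by decide))) rfl
  simp [E0, E1, negAct_one, ofAdd_sub, div_eq_mul_inv]

theorem E0_one : (E0 0 0 : GammaProd k m) = 1 := rfl

theorem E0_inv (a : Fin k → ℤ) (b : Fin m → ℤ) : (E0 a b)⁻¹ = E0 (-a) (-b) := by
  rw [inv_eq_iff_mul_eq_one, E00]; simp [E0_one]

theorem E1_inv (a : Fin k → ℤ) (b : Fin m → ℤ) : (E1 a b)⁻¹ = E1 a (-b) := by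
  rw [inv_eq_iff_mul_eq_one, E11]; simp [E0_one]

/-- Normal form of an automorphism. -/
def IsForm (φ : MulAut (GammaProd k m)) (A : Matrix (Fin k) (Fin k) ℤ) (c : Fin k → ℤ)
    (B : Matrix (Fin m) (Fin m) ℤ) : Prop :=
  (∀ a b, φ (E0 a b) = E0 (A.mulVec a) (B.mulVec b)) ∧
  (∀ a b, φ (E1 a b) = E1 (A.mulVec a + c) (B.mulVec b))

theorem self_add_zero {n : ℕ} {b : Fin n → ℤ} (h : b + b = 0) : b = 0 := by
  ext i
  have := congrFun h i
  simp only [Pi.add_apply, Pi.zero_apply] at this ⊢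
  omega

theorem exists_form (hk : 2 ≤ k) (φ : MulAut (GammaProd k m)) : ∃ A c B, IsForm φ A c B := by
  have h1 : ∀ a : Fin k → ℤ, ∃ u : Fin k → ℤ, φ (E1 a 0) = E1 u 0 := by
    intro a
    have hsq : φ (E1 a 0) * φ (E1 a 0) = 1 := by
      rw [← map_mul, E11]; simp [E0_one]
    rcases E_cases (φ (E1 a 0)) with ⟨x, y, h⟩ | ⟨x, y, h⟩
    · rw [h, E00, ← E0_one, E0_inj] at hsq
      rw [self_add_zero hsq.1, self_add_zero hsq.2, E0_one, ← map_one φ] at h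
      exact absurd (φ.injective h).symm (E0_ne_E1 _ _ _ _)
    · rw [h, E11, ← E0_one, E0_inj] at hsq
      rw [self_add_zero hsq.2] at h
      exact ⟨x, h⟩
  choose u hu using h1
  have h2 : ∀ a : Fin k → ℤ, φ (E0 a 0) = E0 (u a - u 0) 0 := by
    intro a
    have : (E0 a 0 : GammaProd k m) = E1 a 0 * E1 0 0 := by rw [E11]; simp
    rw [this, map_mul, hu, hu, E11]; simp
  have h3 : ∀ b : Fin m → ℤ, ∃ w : Fin m → ℤ, φ (E0 0 b) = E0 0 w := by
    intro b
    have hc : ∀ g, g * φ (E0 0 b) = φ (E0 0 b) * g := by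
      intro g
      obtain ⟨g, rfl⟩ := φ.surjective g
      rw [← map_mul, ← map_mul]
      congr 1
      rcases E_cases g with ⟨x, y, rfl⟩ | ⟨x, y, rfl⟩
      · rw [E00, E00, add_comm x, add_comm y]
      · rw [E10, E01, add_comm y]; simp
    rcases E_cases (φ (E0 0 b)) with ⟨x, y, h⟩ | ⟨x, y, h⟩
    · have h4 := hc (E1 0 0)
      rw [h, E10, E01, E1_inj] at h4
      have : x = 0 := by
        apply self_add_zero
        have h5 := h4.1
        rw [zero_sub, add_zero] at h5
        nth_rewrite 1 [← h5]
        simp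
      rw [this] at h
      exact ⟨y, h⟩
    · exfalso
      have h4 := hc (E0 (fun _ => 1) 0)
      rw [h, E01, E10, E1_inj] at h4
      have h5 := congrFun h4.1 ⟨0, by omega⟩
      simp only [Pi.add_apply, Pi.sub_apply] at h5
      omega
  choose w hw using h3
  let α : (Fin k → ℤ) →+ (Fin k → ℤ) := AddMonoidHom.mk' (fun a => u a - u 0) (by
    intro a a'
    have : φ (E0 (a + a') 0) = φ (E0 a 0) * φ (E0 a' 0) := by
      rw [← map_mul, E00, add_zero]
    rw [h2, h2, h2, E00, E0_inj] at this
    exact this.1)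
  let β : (Fin m → ℤ) →+ (Fin m → ℤ) := AddMonoidHom.mk' w (by
    intro b b'
    have : φ (E0 0 (b + b')) = φ (E0 0 b) * φ (E0 0 b') := by
      rw [← map_mul, E00, add_zero]
    rw [hw, hw, hw, E00, E0_inj] at this
    exact this.2)
  have hA : ∀ a, (LinearMap.toMatrix' α.toIntLinearMap).mulVec a = u a - u 0 := by
    intro a
    rw [LinearMap.toMatrix'_mulVec]; rfl
  have hB : ∀ b, (LinearMap.toMatrix' β.toIntLinearMap).mulVec b = w b := by
    intro b
    rw [LinearMap.toMatrix'_mulVec]; rfl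
  refine ⟨LinearMap.toMatrix' α.toIntLinearMap, u 0, LinearMap.toMatrix' β.toIntLinearMap, ?_, ?_⟩
  · intro a b
    have : (E0 a b : GammaProd k m) = E0 a 0 * E0 0 b := by rw [E00]; simp
    rw [this, map_mul, h2, hw, E00, hA, hB]; simp
  · intro a b
    have : (E1 a b : GammaProd k m) = E0 0 b * E1 a 0 := by rw [E01]; simp
    rw [this, map_mul, hu, hw, E01, hA, hB]; simp

theorem form_pow (φ : MulAut (GammaProd k m)) (A c B) (h : IsForm φ A c B) (j : ℕ) :
    ∃ c', IsForm (φ ^ j) (A ^ j) c' (B ^ j) ∧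
      ∀ v, (fun v => ((Int.castRingHom (ZMod 2)).mapMatrix A).mulVec v + red c)^[j] v =
        ((Int.castRingHom (ZMod 2)).mapMatrix (A ^ j)).mulVec v + red c' := by
  induction j with
  | zero =>
    refine ⟨0, ⟨?_, ?_⟩, ?_⟩
    · intro a b; simp
    · intro a b; simp
    · intro v
      have : red (0 : Fin k → ℤ) = 0 := by ext; simp [red]
      rw [this]; simp
  | succ j ih =>
    obtain ⟨c', ⟨h1, h2⟩, h3⟩ := ih
    refine ⟨A.mulVec c' + c, ⟨?_, ?_⟩, ?_⟩
    · intro a b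
      rw [pow_succ', MulAut.mul_apply, h1, h.1]; simp [pow_succ']
    · intro a b
      rw [pow_succ', MulAut.mul_apply, h2, h.2]; simp [pow_succ', Matrix.mulVec_add, add_assoc]
    · intro v
      rw [Function.iterate_succ_apply', h3]
      have : red (A.mulVec c' + c) = red (A.mulVec c') + red c := by ext; simp [red]
      rw [this, red_mulVec, pow_succ', map_mul, Matrix.mulVec_add, Matrix.mulVec_mulVec, add_assoc]

/-- The invariant of twisted conjugacy. -/
noncomputable def toX (A : Matrix (Fin k) (Fin k) ℤ) (B : Matrix (Fin m) (Fin m) ℤ) (g : GammaProd k m) :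
    (Coker (1 - A) ⊕ Coker (1 + A)) × Coker (1 - B) :=
  (if Multiplicative.toAdd g.1.right = 0 then Sum.inl (Submodule.Quotient.mk (Multiplicative.toAdd g.1.left))
    else Sum.inr (Submodule.Quotient.mk (Multiplicative.toAdd g.1.left)),
    Submodule.Quotient.mk (Multiplicative.toAdd g.2))

theorem toX_E0 (A : Matrix (Fin k) (Fin k) ℤ) (B : Matrix (Fin m) (Fin m) ℤ) (a b) :
    toX A B (E0 a b) = (Sum.inl (Submodule.Quotient.mk a), Submodule.Quotient.mk b) := by
  simp [toX, E0]

theorem toX_E1 (A : Matrix (Fin k) (Fin k) ℤ) (B : Matrix (Fin m) (Fin m) ℤ) (a b) :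
    toX A B (E1 a b) = (Sum.inr (Submodule.Quotient.mk a), Submodule.Quotient.mk b) := by
  simp [toX, E1]

/-- The involution. -/
def invX (A : Matrix (Fin k) (Fin k) ℤ) (B : Matrix (Fin m) (Fin m) ℤ) (c : Fin k → ℤ) :
    (Coker (1 - A) ⊕ Coker (1 + A)) × Coker (1 - B) → (Coker (1 - A) ⊕ Coker (1 + A)) × Coker (1 - B) :=
  fun x => (Sum.map (fun y => Submodule.Quotient.mk (-c) - y) (fun y => Submodule.Quotient.mk c - y) x.1, x.2)

theorem invX_invol (A : Matrix (Fin k) (Fin k) ℤ) (B : Matrix (Fin m) (Fin m) ℤ) (c : Fin k → ℤ) (x) :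
    invX A B c (invX A B c x) = x := by
  rcases x with ⟨x | x, y⟩ <;> simp [invX]

theorem twisted_iff (φ : MulAut (GammaProd k m)) (A c B) (h : IsForm φ A c B) (g g' : GammaProd k m) :
    twistedConj (φ : GammaProd k m →* GammaProd k m) g g' ↔
      (toX A B g = toX A B g' ∨ toX A B g = invX A B c (toX A B g')) := by
  have hh : twistedConj (φ : GammaProd k m →* GammaProd k m) g g' ↔
      (∃ x y, g = E0 x y * g' * (φ (E0 x y))⁻¹) ∨ (∃ x y, g = E1 x y * g' * (φ (E1 x y))⁻¹) := by
    constructor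
    · rintro ⟨t, ht⟩
      rcases E_cases t with ⟨x, y, rfl⟩ | ⟨x, y, rfl⟩
      · exact Or.inl ⟨x, y, ht⟩
      · exact Or.inr ⟨x, y, ht⟩
    · rintro (⟨x, y, ht⟩ | ⟨x, y, ht⟩)
      · exact ⟨_, ht⟩
      · exact ⟨_, ht⟩
  rw [hh]
  simp only [h.1, h.2, E0_inv, E1_inv]
  rcases E_cases g with ⟨a, b, rfl⟩ | ⟨a, b, rfl⟩ <;> rcases E_cases g' with ⟨a', b', rfl⟩ | ⟨a', b', rfl⟩
  · simp only [E00, E01, E10, E11, toX_E0, invX, Sum.map_inl, Prod.mk.injEq, Sum.inl.injEq, E0_inj,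
      ← Submodule.Quotient.mk_sub, coker_eq, Matrix.sub_mulVec, Matrix.add_mulVec, Matrix.one_mulVec]
    refine or_congr ?_ ?_
    all_goals
      constructor
      · rintro ⟨x, y, hx, hy⟩
        exact ⟨⟨x, by linear_combination -hx⟩, ⟨y, by linear_combination -hy⟩⟩
      · rintro ⟨⟨x, hx⟩, ⟨y, hy⟩⟩
        exact ⟨x, y, by linear_combination -hx, by linear_combination -hy⟩
  · simp [E00, E01, E10, E11, toX_E0, toX_E1, invX, E0_ne_E1]
  · simp [E00, E01, E10, E11, toX_E0, toX_E1, invX, (E0_ne_E1 _ _ _ _).symm]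
  · simp only [E00, E01, E10, E11, toX_E1, invX, Sum.map_inr, Prod.mk.injEq, Sum.inr.injEq, E1_inj,
      ← Submodule.Quotient.mk_sub, coker_eq, Matrix.sub_mulVec, Matrix.add_mulVec, Matrix.one_mulVec]
    refine or_congr ?_ ?_
    all_goals
      constructor
      · rintro ⟨x, y, hx, hy⟩
        exact ⟨⟨x, by linear_combination -hx⟩, ⟨y, by linear_combination -hy⟩⟩
      · rintro ⟨⟨x, hx⟩, ⟨y, hy⟩⟩
        exact ⟨x, y, by linear_combination -hx, by linear_combination -hy⟩
end GroupPart

theorem twisted_quot {k m : ℕ} (φ : MulAut (GammaProd k m)) (A c B) (h : IsForm φ A c B)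
    (hf : Finite (Quot (twistedConj (φ : GammaProd k m →* GammaProd k m)))) :
    Finite ((Coker (1 - A) ⊕ Coker (1 + A)) × Coker (1 - B)) ∧
      Nat.card ((Coker (1 - A) ⊕ Coker (1 + A)) × Coker (1 - B)) +
        Nat.card {x // invX A B c x = x} =
      2 * reidemeisterNumber (φ : GammaProd k m →* GammaProd k m) := by
  let r : (Coker (1 - A) ⊕ Coker (1 + A)) × Coker (1 - B) →
    (Coker (1 - A) ⊕ Coker (1 + A)) × Coker (1 - B) → Prop := fun x y => x = y ∨ x = invX A B c y
  have hreq : Equivalence r := by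
    refine ⟨fun x => Or.inl rfl, ?_, ?_⟩
    · rintro x y (rfl | rfl)
      · exact Or.inl rfl
      · exact Or.inr (invX_invol A B c y).symm
    · rintro x y z (rfl | rfl) (rfl | rfl)
      · exact Or.inl rfl
      · exact Or.inr rfl
      · exact Or.inr rfl
      · exact Or.inl (invX_invol A B c z)
  have htw : ∀ g g', twistedConj (φ : GammaProd k m →* GammaProd k m) g g' ↔
      r (toX A B g) (toX A B g') := twisted_iff φ A c B h
  have hsurj : Function.Surjective (toX A B) := by
    rintro ⟨x | x, y⟩
    · obtain ⟨a, rfl⟩ := Submodule.Quotient.mk_surjective _ x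
      obtain ⟨b, rfl⟩ := Submodule.Quotient.mk_surjective _ y
      exact ⟨E0 a b, toX_E0 A B a b⟩
    · obtain ⟨a, rfl⟩ := Submodule.Quotient.mk_surjective _ x
      obtain ⟨b, rfl⟩ := Submodule.Quotient.mk_surjective _ y
      exact ⟨E1 a b, toX_E1 A B a b⟩
  let F : Quot (twistedConj (φ : GammaProd k m →* GammaProd k m)) → Quot r :=
    Quot.map (toX A B) (fun g g' hg => (htw g g').1 hg)
  have hF : Function.Bijective F := by
    constructor
    · rintro ⟨g⟩ ⟨g'⟩ hg
      have hg' : Quot.mk r (toX A B g) = Quot.mk r (toX A B g') := hg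
      exact Quot.sound ((htw g g').2 (hreq.quot_mk_eq_iff _ _ |>.1 hg'))
    · rintro ⟨x⟩
      obtain ⟨g, rfl⟩ := hsurj x
      exact ⟨Quot.mk _ g, rfl⟩
  have hfr : Finite (Quot r) := Finite.of_surjective F hF.2
  have := invol_card (invX A B c) (invX_invol A B c) r (fun x y => Iff.rfl) hfr
  rw [reidemeisterNumber, Nat.card_congr (Equiv.ofBijective F hF)]
  exact this

theorem fixX_card {k m : ℕ} (A : Matrix (Fin k) (Fin k) ℤ) (B : Matrix (Fin m) (Fin m) ℤ)
    (c : Fin k → ℤ) [Finite ((Coker (1 - A) ⊕ Coker (1 + A)) × Coker (1 - B))]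
    [Finite (Coker (1 - A))] [Finite (Coker (1 + A))] :
    Nat.card {x // invX A B c x = x} =
      (Nat.card {x : Coker (1 - A) // Submodule.Quotient.mk (-c) - x = x} +
       Nat.card {x : Coker (1 + A) // Submodule.Quotient.mk c - x = x}) * Nat.card (Coker (1 - B)) := by
  rw [← Nat.card_sum, ← Nat.card_prod]
  refine (Nat.card_congr (Equiv.ofBijective
    (fun p => (⟨(Sum.map Subtype.val Subtype.val p.1, p.2), ?_⟩ : {x // invX A B c x = x})) ⟨?_, ?_⟩)).symm
  · rcases p with ⟨⟨x, hx⟩ | ⟨x, hx⟩, y⟩ <;> simp only [invX, Sum.map_inl, Sum.map_inr, hx]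
  · rintro ⟨⟨x, hx⟩ | ⟨x, hx⟩, y⟩ ⟨⟨x', hx'⟩ | ⟨x', hx'⟩, y'⟩ h <;>
      simpa [Subtype.ext_iff] using h
  · rintro ⟨⟨x | x, y⟩, h⟩
    · exact ⟨(Sum.inl ⟨x, by simpa [invX] using h⟩, y), rfl⟩
    · exact ⟨(Sum.inr ⟨x, by simpa [invX] using h⟩, y), rfl⟩

theorem reid_formula {k m : ℕ} (φ : MulAut (GammaProd k m)) (A c B) (h : IsForm φ A c B)
    (hf : Finite (Quot (twistedConj (φ : GammaProd k m →* GammaProd k m)))) :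
    2 * reidemeisterNumber (φ : GammaProd k m →* GammaProd k m) =
      ((1 - A).det.natAbs + (1 + A).det.natAbs + 2 * Nat.card {v : Fin k → ZMod 2 //
        ((Int.castRingHom (ZMod 2)).mapMatrix A).mulVec v + red c = v}) * (1 - B).det.natAbs := by
  obtain ⟨hX, hcard⟩ := twisted_quot φ A c B h hf
  have f3 : Finite (Coker (1 - B)) := Finite.of_surjective
    (Prod.snd : (Coker (1 - A) ⊕ Coker (1 + A)) × Coker (1 - B) → _)
    (fun y => ⟨(Sum.inl 0, y), rfl⟩)
  have f12 : Finite (Coker (1 - A) ⊕ Coker (1 + A)) := Finite.of_surjective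
    (Prod.fst : (Coker (1 - A) ⊕ Coker (1 + A)) × Coker (1 - B) → _)
    (fun y => ⟨(y, 0), rfl⟩)
  have f1 : Finite (Coker (1 - A)) := Finite.of_injective
    (Sum.inl : _ → Coker (1 - A) ⊕ Coker (1 + A)) Sum.inl_injective
  have f2 : Finite (Coker (1 + A)) := Finite.of_injective
    (Sum.inr : _ → Coker (1 - A) ⊕ Coker (1 + A)) Sum.inr_injective
  have d1 := coker_det _ f1
  have d2 := coker_det _ f2
  have d3 := coker_det _ f3
  have hneg : ∀ v : Fin k → ZMod 2, -v = v := fun v => by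
    ext i
    exact (by decide : ∀ a : ZMod 2, -a = a) (v i)
  have hadd : ∀ v : Fin k → ZMod 2, v + v = 0 := fun v => by
    ext i
    exact (by decide : ∀ a : ZMod 2, a + a = 0) (v i)
  have hrn : red (-c) = red c := by
    rw [← hneg (red c)]; ext i; simp [red]
  have key : ∀ v : Fin k → ZMod 2, ∀ w : Fin k → ZMod 2, v + w = red c ↔ w + red c = v := by
    intro v w
    constructor
    · intro h; rw [← h]; linear_combination hadd w
    · intro h; rw [← h]; linear_combination hadd w
  have e1 : Nat.card {v : Fin k → ZMod 2 // ((Int.castRingHom (ZMod 2)).mapMatrix (1 - A)).mulVec v = red c} =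
      Nat.card {v : Fin k → ZMod 2 // ((Int.castRingHom (ZMod 2)).mapMatrix A).mulVec v + red c = v} := by
    refine Nat.card_congr (Equiv.subtypeEquivRight fun v => ?_)
    rw [map_sub, map_one, Matrix.sub_mulVec, Matrix.one_mulVec, sub_eq_add_neg, hneg, key]
  have e2 : Nat.card {v : Fin k → ZMod 2 // ((Int.castRingHom (ZMod 2)).mapMatrix (1 + A)).mulVec v = red c} =
      Nat.card {v : Fin k → ZMod 2 // ((Int.castRingHom (ZMod 2)).mapMatrix A).mulVec v + red c = v} := by
    refine Nat.card_congr (Equiv.subtypeEquivRight fun v => ?_)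
    rw [map_add, map_one, Matrix.add_mulVec, Matrix.one_mulVec, key]
  rw [fixX_card, Nat.card_prod, Nat.card_sum, coker_card _ d1, coker_card _ d2, coker_card _ d3,
    fix_card _ d1, fix_card _ d2, hrn, e1, e2] at hcard
  rw [← hcard]
  ring

theorem reid_mem (k m : ℕ) (hk : 2 ≤ k)
    (φ : MulAut (GammaProd k m))
    (hfin : ∀ j : ℕ, 0 < j →
      Finite (Quot (twistedConj
        ((φ ^ j : MulAut (GammaProd k m)) : GammaProd k m →* GammaProd k m)))) :
    (fun j : ℕ => (reidemeisterNumber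
      ((φ ^ (j + 1) : MulAut (GammaProd k m)) : GammaProd k m →* GammaProd k m) : ℂ)) ∈ expRing := by
  obtain ⟨A, c, B, h⟩ := exists_form hk φ
  have hm := expRing.mul_mem (expRing.add_mem (half_det_mem A) (fixed_mem
    (fun v : Fin k → ZMod 2 => ((Int.castRingHom (ZMod 2)).mapMatrix A).mulVec v + red c)))
    (abs_det_mem B)
  convert hm using 1
  ext j
  obtain ⟨c', h1, h2⟩ := form_pow φ A c B h (j + 1)
  have h3 := reid_formula _ _ _ _ h1 (hfin (j + 1) (Nat.succ_pos j))
  have h4 : ((2 * reidemeisterNumber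
      ((φ ^ (j + 1) : MulAut (GammaProd k m)) : GammaProd k m →* GammaProd k m) : ℕ) : ℂ) = _ :=
    congrArg (Nat.cast : ℕ → ℂ) h3
  simp only [Pi.mul_apply, Pi.add_apply, h2]
  push_cast [Nat.cast_natAbs] at h4 ⊢
  linear_combination h4 / 2

/-- for `Γ = (ℤᵏ ⋊ ℤ/2ℤ) × ℤᵐ` (`k ≥ 2`, `m ≥ 1`) and an automorphism `φ` of
`Γ` with all `R(φⁿ)` finite, the Reidemeister zeta function of `φ` is rational: there are
`r > 0` and polynomials `P, Q ∈ ℂ[z]` with `Q` nonvanishing on `‖z‖ < r` such that for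
`‖z‖ < r` the series `∑_{n≥1} R(φⁿ) zⁿ/n` converges and the exponential of its sum is
`P(z)/Q(z)`. -/
theorem stmt18 (k m : ℕ) (hk : 2 ≤ k) (hm : 1 ≤ m)
    (φ : MulAut (GammaProd k m))
    (hfin : ∀ j : ℕ, 0 < j →
      Finite (Quot (twistedConj
        ((φ ^ j : MulAut (GammaProd k m)) : GammaProd k m →* GammaProd k m)))) :
    ∃ (r : ℝ) (P Q : Polynomial ℂ), 0 < r ∧
      (∀ z : ℂ, ‖z‖ < r → Q.eval z ≠ 0) ∧
      ∀ z : ℂ, ‖z‖ < r →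
        ∃ s : ℂ,
          HasSum (fun j : ℕ =>
            (reidemeisterNumber
              ((φ ^ (j + 1) : MulAut (GammaProd k m)) : GammaProd k m →* GammaProd k m) : ℂ)
              * z ^ (j + 1) / (j + 1)) s ∧
          Complex.exp s = P.eval z / Q.eval z := by
  obtain ⟨r, P, Q, hr, _, hQ, hs⟩ := expRing_rational _ (reid_mem k m hk φ hfin)
  exact ⟨r, P, Q, hr, hQ, hs⟩
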